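/- For a word 𝔦 in the δ-stopping 𝓘_{a,δ}, the height of the image S_𝔦([0,1]²) over any base interval of length at most δ is at most a constant multiple of δ: there is a constant K>0, independent of δ, 𝔦, such that whenever 𝔦∈𝓘_{a,δ} and 0 ≤ a₀ ≤ b₀ ≤ 1 satisfy |f_𝔦(b₀) − f_𝔦(a₀)| ≤ δ, then for all a',b' ∈ [a₀,b₀], |g_𝔦(b',1) − g_𝔦(a',0)| ≤ K·δ. -/

import Mathlib

/-!
Setting (Falconer–Fraser–Lee, "L^q-spectra of measures on planar non-conformal attractors"):
a finite family of C^{1+α} skew-product contractions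
`S i (x,y) = (f i x, g i (x,y))` of the unit square, satisfying a domination
condition on the (lower triangular) Jacobians.
-/

open Set Filter Topology MeasureTheory
open scoped Classical ENNReal

noncomputable section

/-- The closed unit square `[0,1]² ⊆ ℝ²`. -/
def unitSq : Set (ℝ × ℝ) := Set.Icc (0:ℝ) 1 ×ˢ Set.Icc (0:ℝ) 1

variable {ι : Type*} [Fintype ι]

/-- The skew-product map `S_i(x,y) = (f_i x, g_i (x,y))`. -/
def Smap (f : ι → ℝ → ℝ) (g : ι → ℝ × ℝ → ℝ) (i : ι) : ℝ × ℝ → ℝ × ℝ :=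
  fun a => (f i a.1, g i a)

/-- The composition `S_𝔦 = S_{i₁} ∘ ⋯ ∘ S_{i_k}` along a finite word `𝔦 = [i₁, …, i_k]`. -/
def Sword (f : ι → ℝ → ℝ) (g : ι → ℝ × ℝ → ℝ) : List ι → ℝ × ℝ → ℝ × ℝ
  | [] => id
  | i :: l => Smap f g i ∘ Sword f g l

/-- The first component `f_𝔦 = f_{i₁} ∘ ⋯ ∘ f_{i_k}` of `S_𝔦` (a function of `x` only). -/
def fword (f : ι → ℝ → ℝ) : List ι → ℝ → ℝ
  | [] => id
  | i :: l => f i ∘ fword f l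

/-- Top-left entry `f_{𝔦,x}(a)` of the (lower triangular) Jacobian `D_a S_𝔦`. -/
def fxw (f : ι → ℝ → ℝ) (g : ι → ℝ × ℝ → ℝ) (l : List ι) (a : ℝ × ℝ) : ℝ :=
  deriv (fun x => (Sword f g l (x, a.2)).1) a.1

/-- Bottom-left entry `g_{𝔦,x}(a)` of the Jacobian `D_a S_𝔦`. -/
def gxw (f : ι → ℝ → ℝ) (g : ι → ℝ × ℝ → ℝ) (l : List ι) (a : ℝ × ℝ) : ℝ :=
  deriv (fun x => (Sword f g l (x, a.2)).2) a.1

/-- Bottom-right entry `g_{𝔦,y}(a)` of the Jacobian `D_a S_𝔦`. -/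
def gyw (f : ι → ℝ → ℝ) (g : ι → ℝ × ℝ → ℝ) (l : List ι) (a : ℝ × ℝ) : ℝ :=
  deriv (fun y => (Sword f g l (a.1, y)).2) a.2

/-- The standing hypotheses: `|𝓘| ≥ 2`; each `S_i(x,y) = (f_i x, g_i(x,y))` maps the unit
square into itself; `f_i, g_i` are `C^{1+α}` contractions (`0 < α ≤ 1`); and the
domination condition `inf f_{i,x} > sup g_{i,y} ≥ inf g_{i,y} ≥ d > 0` holds. -/
structure IFSHyp (f : ι → ℝ → ℝ) (g : ι → ℝ × ℝ → ℝ) (α d : ℝ) : Prop where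
  card2 : 2 ≤ Fintype.card ι
  alpha_pos : 0 < α
  alpha_le_one : α ≤ 1
  d_pos : 0 < d
  maps_f : ∀ i, Set.MapsTo (f i) (Set.Icc 0 1) (Set.Icc 0 1)
  maps_g : ∀ i, Set.MapsTo (g i) unitSq (Set.Icc 0 1)
  diff_f : ∀ i, Differentiable ℝ (f i)
  diff_g : ∀ i, Differentiable ℝ (g i)
  holder_f : ∀ i, ∃ H : ℝ, ∀ x ∈ Set.Icc (0:ℝ) 1, ∀ y ∈ Set.Icc (0:ℝ) 1,
      |deriv (f i) x - deriv (f i) y| ≤ H * |x - y| ^ α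
  holder_g : ∀ i, ∃ H : ℝ, ∀ a ∈ unitSq, ∀ b ∈ unitSq,
      ‖fderiv ℝ (g i) a - fderiv ℝ (g i) b‖ ≤ H * ‖a - b‖ ^ α
  contr_f : ∀ i, ∃ c, 0 ≤ c ∧ c < 1 ∧ ∀ x ∈ Set.Icc (0:ℝ) 1, ∀ y ∈ Set.Icc (0:ℝ) 1,
      |f i x - f i y| ≤ c * |x - y|
  contr_g : ∀ i, ∃ c, 0 ≤ c ∧ c < 1 ∧ ∀ a ∈ unitSq, ∀ b ∈ unitSq,
      |g i a - g i b| ≤ c * ‖a - b‖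
  dom : ∀ i, sSup (gyw f g [i] '' unitSq) < sInf (fxw f g [i] '' unitSq)
  dom_d : ∀ i, ∀ a ∈ unitSq, d ≤ gyw f g [i] a

/-- The larger singular value of the lower triangular matrix `A = [[a,0],[b,c]]`, i.e. the
square root of the larger eigenvalue of `AᵀA`, in explicit closed form. -/
def sv1 (a b c : ℝ) : ℝ :=
  Real.sqrt (((a ^ 2 + b ^ 2 + c ^ 2) +
    Real.sqrt ((a ^ 2 + b ^ 2 + c ^ 2) ^ 2 - 4 * (a * c) ^ 2)) / 2)

/-- The smaller singular value of the lower triangular matrix `A = [[a,0],[b,c]]`, i.e. the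
square root of the smaller eigenvalue of `AᵀA`, in explicit closed form. -/
def sv2 (a b c : ℝ) : ℝ :=
  Real.sqrt (((a ^ 2 + b ^ 2 + c ^ 2) -
    Real.sqrt ((a ^ 2 + b ^ 2 + c ^ 2) ^ 2 - 4 * (a * c) ^ 2)) / 2)

/-- `α₁(D_a S_𝔦)`, the larger singular value of the Jacobian. -/
def alphaOne (f : ι → ℝ → ℝ) (g : ι → ℝ × ℝ → ℝ) (l : List ι) (a : ℝ × ℝ) : ℝ :=
  sv1 (fxw f g l a) (gxw f g l a) (gyw f g l a)

/-- `α₂(D_a S_𝔦)`, the smaller singular value of the Jacobian. -/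
def alphaTwo (f : ι → ℝ → ℝ) (g : ι → ℝ × ℝ → ℝ) (l : List ι) (a : ℝ × ℝ) : ℝ :=
  sv2 (fxw f g l a) (gxw f g l a) (gyw f g l a)

/-- `η = sup_{i, a, b} g_{i,y}(a) / f_{i,x}(b)`. -/
def etaSup (f : ι → ℝ → ℝ) (g : ι → ℝ × ℝ → ℝ) : ℝ :=
  sSup {x : ℝ | ∃ i : ι, ∃ a ∈ unitSq, ∃ b ∈ unitSq, x = gyw f g [i] a / fxw f g [i] b}

/-- `p(𝔦) = p_{i₁} ⋯ p_{i_k}`. -/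
def pword (p : ι → ℝ) (l : List ι) : ℝ := (l.map p).prod

/-- `(p_i)` is a probability vector with all entries in `(0,1)`. -/
def ProbVec (p : ι → ℝ) : Prop := (∀ i, 0 < p i ∧ p i < 1) ∧ ∑ i, p i = 1

/-- The `q`-modified singular value function
`ψ^{s,q}_a(𝔦) = p(𝔦)^q α₁(D_aS_𝔦)^βq α₂(D_aS_𝔦)^(s−βq)` (real exponents). -/
def psiSV (f : ι → ℝ → ℝ) (g : ι → ℝ × ℝ → ℝ) (p : ι → ℝ) (s q βq : ℝ)
    (a : ℝ × ℝ) (l : List ι) : ℝ :=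
  pword p l ^ q * alphaOne f g l a ^ βq * alphaTwo f g l a ^ (s - βq)

/-- `Ψ^{s,q}_{a,k} = Σ_{𝔦 ∈ 𝓘^k} ψ^{s,q}_a(𝔦)`. -/
def PsiSum (f : ι → ℝ → ℝ) (g : ι → ℝ × ℝ → ℝ) (p : ι → ℝ) (s q βq : ℝ)
    (a : ℝ × ℝ) (k : ℕ) : ℝ :=
  ∑ w : Fin k → ι, psiSV f g p s q βq a (List.ofFn w)

/-- The `δ`-stopping `𝓘_{a,δ} = {𝔦 : α₂(D_aS_𝔦) < δ ≤ α₂(D_aS_𝔦̂)}`, where `𝔦̂` drops the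
last letter of `𝔦`. -/
def stopping (f : ι → ℝ → ℝ) (g : ι → ℝ × ℝ → ℝ) (a : ℝ × ℝ) (δ : ℝ) : Set (List ι) :=
  {l | l ≠ [] ∧ alphaTwo f g l a < δ ∧ δ ≤ alphaTwo f g l.dropLast a}

/-- `q`-th power moment sum of a measure on `ℝ` over the `δ`-mesh intervals of positive
measure. -/
def msum1 (ν : Measure ℝ) (q δ : ℝ) : ℝ :=
  ∑' k : ℤ, if 0 < ν (Set.Icc ((k : ℝ) * δ) (((k : ℝ) + 1) * δ)) then
    (ν (Set.Icc ((k : ℝ) * δ) (((k : ℝ) + 1) * δ))).toReal ^ q else 0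

/-- `q`-th power moment sum of a measure on `ℝ²` over the `δ`-mesh squares of positive
measure. -/
def msum2 (ν : Measure (ℝ × ℝ)) (q δ : ℝ) : ℝ :=
  ∑' k : ℤ × ℤ,
    if 0 < ν (Set.Icc ((k.1 : ℝ) * δ) (((k.1 : ℝ) + 1) * δ) ×ˢ
        Set.Icc ((k.2 : ℝ) * δ) (((k.2 : ℝ) + 1) * δ)) then
      (ν (Set.Icc ((k.1 : ℝ) * δ) (((k.1 : ℝ) + 1) * δ) ×ˢ
        Set.Icc ((k.2 : ℝ) * δ) (((k.2 : ℝ) + 1) * δ))).toReal ^ q else 0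

/-- Upper `L^q`-spectrum of a measure on `ℝ²`. -/
def upperTau2 (ν : Measure (ℝ × ℝ)) (q : ℝ) : ℝ :=
  limsup (fun δ => Real.log (msum2 ν q δ) / (-Real.log δ)) (𝓝[>] (0:ℝ))

/-- Lower `L^q`-spectrum of a measure on `ℝ²`. -/
def lowerTau2 (ν : Measure (ℝ × ℝ)) (q : ℝ) : ℝ :=
  liminf (fun δ => Real.log (msum2 ν q δ) / (-Real.log δ)) (𝓝[>] (0:ℝ))

lemma sv2_lower_bound {a b c C : ℝ} (hc : 0 < c) (hca : c ≤ a) (hb : |b| ≤ C * a) :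
    c ≤ Real.sqrt (2 + C ^ 2) * sv2 a b c := by
  have ha : 0 < a := hc.trans_le hca
  have hT : 0 < a ^ 2 + b ^ 2 + c ^ 2 := by positivity
  have hb2 : b ^ 2 ≤ C ^ 2 * a ^ 2 := by
    rw [← mul_pow, ← sq_abs b]
    exact pow_le_pow_left₀ (abs_nonneg b) hb 2
  have hTa : a ^ 2 + b ^ 2 + c ^ 2 ≤ (2 + C ^ 2) * a ^ 2 := by nlinarith
  generalize hTdef : a ^ 2 + b ^ 2 + c ^ 2 = T at hT hTa
  have hsqrt : Real.sqrt (T ^ 2 - 4 * (a * c) ^ 2) ≤ T - 2 * (a * c) ^ 2 / T := by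
    apply Real.sqrt_le_iff.2
    constructor
    · rw [sub_nonneg, div_le_iff₀ hT]
      have h2 : 2 * (a * c) ≤ T := by nlinarith [sq_nonneg (a - c), sq_nonneg b]
      have : 0 < a * c := by positivity
      nlinarith
    · have h3 : 0 ≤ (2 * (a * c) ^ 2 / T) ^ 2 := sq_nonneg _
      have h4 : T * (2 * (a * c) ^ 2 / T) = 2 * (a * c) ^ 2 := by field_simp
      nlinarith
  have hquot : c ^ 2 / (2 + C ^ 2) ≤ (a * c) ^ 2 / T := by
    rw [div_le_div_iff₀ (by positivity) hT, mul_pow]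
    nlinarith [mul_le_mul_of_nonneg_left hTa (sq_nonneg c)]
  rw [sv2, hTdef, ← Real.sqrt_mul (by positivity)]
  apply Real.le_sqrt_of_sq_le
  rw [div_le_iff₀ (by positivity)] at hquot
  have h5 : (a * c) ^ 2 / T ≤ (T - Real.sqrt (T ^ 2 - 4 * (a * c) ^ 2)) / 2 := by
    have : 2 * (a * c) ^ 2 / T = 2 * ((a * c) ^ 2 / T) := by ring
    linarith
  calc c ^ 2 ≤ (a * c) ^ 2 / T * (2 + C ^ 2) := hquot
    _ ≤ (T - Real.sqrt (T ^ 2 - 4 * (a * c) ^ 2)) / 2 * (2 + C ^ 2) := by gcongr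
    _ = _ := by ring

section Words

variable {κ : Type*} {f : κ → ℝ → ℝ} {g : κ → ℝ × ℝ → ℝ}

lemma Sword_fst (l : List κ) (a : ℝ × ℝ) : (Sword f g l a).1 = fword f l a.1 := by
  induction l with
  | nil => rfl
  | cons i l ih => simp [Sword, fword, Smap, ih]

lemma fxw_eq_deriv_fword (l : List κ) (a : ℝ × ℝ) : fxw f g l a = deriv (fword f l) a.1 := by
  simp only [fxw, Sword_fst]

lemma differentiable_fword (hf : ∀ i, Differentiable ℝ (f i)) (l : List κ) :
    Differentiable ℝ (fword f l) := by
  induction l with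
  | nil => exact differentiable_id
  | cons i l ih => exact (hf i).comp ih

lemma differentiable_Sword (hf : ∀ i, Differentiable ℝ (f i)) (hg : ∀ i, Differentiable ℝ (g i))
    (l : List κ) : Differentiable ℝ (Sword f g l) := by
  induction l with
  | nil => exact differentiable_id
  | cons i l ih => exact (((hf i).comp differentiable_fst).prodMk (hg i)).comp ih

lemma hasDerivAt_fword (hf : ∀ i, Differentiable ℝ (f i)) (l : List κ) (a : ℝ × ℝ) :
    HasDerivAt (fword f l) (fxw f g l a) a.1 := by
  rw [fxw_eq_deriv_fword]
  exact (differentiable_fword hf l _).hasDerivAt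

lemma hasDerivAt_gxw (hf : ∀ i, Differentiable ℝ (f i)) (hg : ∀ i, Differentiable ℝ (g i))
    (l : List κ) (a : ℝ × ℝ) :
    HasDerivAt (fun x => (Sword f g l (x, a.2)).2) (gxw f g l a) a.1 :=
  (differentiable_snd.comp ((differentiable_Sword hf hg l).comp
    (differentiable_id.prodMk (differentiable_const a.2))) a.1).hasDerivAt

lemma hasDerivAt_gyw (hf : ∀ i, Differentiable ℝ (f i)) (hg : ∀ i, Differentiable ℝ (g i))
    (l : List κ) (a : ℝ × ℝ) :
    HasDerivAt (fun y => (Sword f g l (a.1, y)).2) (gyw f g l a) a.2 :=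
  (differentiable_snd.comp ((differentiable_Sword hf hg l).comp
    ((differentiable_const a.1).prodMk differentiable_id)) a.2).hasDerivAt

lemma fxw_singleton (i : κ) (a : ℝ × ℝ) : fxw f g [i] a = deriv (f i) a.1 := by
  rw [fxw_eq_deriv_fword]
  rfl

lemma gxw_singleton (hg : ∀ i, Differentiable ℝ (g i)) (i : κ) (a : ℝ × ℝ) :
    gxw f g [i] a = fderiv ℝ (g i) a (1, 0) :=
  (((hg i) (a.1, a.2)).hasFDerivAt.comp_hasDerivAt a.1
    ((hasDerivAt_id a.1).prodMk (hasDerivAt_const a.1 a.2))).deriv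

lemma gyw_singleton (hg : ∀ i, Differentiable ℝ (g i)) (i : κ) (a : ℝ × ℝ) :
    gyw f g [i] a = fderiv ℝ (g i) a (0, 1) :=
  (((hg i) (a.1, a.2)).hasFDerivAt.comp_hasDerivAt a.2
    ((hasDerivAt_const a.2 a.1).prodMk (hasDerivAt_id a.2))).deriv

lemma fxw_cons (hf : ∀ i, Differentiable ℝ (f i)) (i : κ) (l : List κ) (a : ℝ × ℝ) :
    fxw f g (i :: l) a = fxw f g [i] (Sword f g l a) * fxw f g l a := by
  rw [fxw_singleton, Sword_fst, fxw_eq_deriv_fword, fxw_eq_deriv_fword]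
  exact deriv_comp a.1 (hf i _) (differentiable_fword hf l _)

lemma gyw_cons (hf : ∀ i, Differentiable ℝ (f i)) (hg : ∀ i, Differentiable ℝ (g i))
    (i : κ) (l : List κ) (a : ℝ × ℝ) :
    gyw f g (i :: l) a = gyw f g [i] (Sword f g l a) * gyw f g l a := by
  have hfst : HasDerivAt (fun y => (Sword f g l (a.1, y)).1) 0 a.2 := by
    simp only [Sword_fst]
    exact hasDerivAt_const _ _
  have h := (((hg i) (Sword f g l a)).hasFDerivAt.comp_hasDerivAt a.2
    (hfst.prodMk (hasDerivAt_gyw hf hg l a))).deriv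
  rw [gyw_singleton hg]
  calc gyw f g (i :: l) a = fderiv ℝ (g i) (Sword f g l a) (0, gyw f g l a) := h
    _ = fderiv ℝ (g i) (Sword f g l a) (gyw f g l a • ((0 : ℝ), (1 : ℝ))) := by simp
    _ = _ := by rw [map_smul, smul_eq_mul, mul_comm]

lemma gxw_cons (hf : ∀ i, Differentiable ℝ (f i)) (hg : ∀ i, Differentiable ℝ (g i))
    (i : κ) (l : List κ) (a : ℝ × ℝ) :
    gxw f g (i :: l) a = gxw f g [i] (Sword f g l a) * fxw f g l a +
      gyw f g [i] (Sword f g l a) * gxw f g l a := by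
  have hfst : HasDerivAt (fun x => (Sword f g l (x, a.2)).1) (fxw f g l a) a.1 := by
    simp only [Sword_fst]
    exact hasDerivAt_fword hf l a
  have h := (((hg i) (Sword f g l a)).hasFDerivAt.comp_hasDerivAt a.1
    (hfst.prodMk (hasDerivAt_gxw hf hg l a))).deriv
  rw [gyw_singleton hg, gxw_singleton hg]
  calc gxw f g (i :: l) a = fderiv ℝ (g i) (Sword f g l a) (fxw f g l a, gxw f g l a) := h
    _ = fderiv ℝ (g i) (Sword f g l a)
          (fxw f g l a • ((1 : ℝ), (0 : ℝ)) + gxw f g l a • ((0 : ℝ), (1 : ℝ))) := by simp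
    _ = _ := by rw [map_add, map_smul, map_smul, smul_eq_mul, smul_eq_mul]; ring

end Words

namespace IFSHyp

variable {f : ι → ℝ → ℝ} {g : ι → ℝ × ℝ → ℝ} {α d : ℝ}

lemma mapsTo_Sword (h : IFSHyp f g α d) (l : List ι) :
    MapsTo (Sword f g l) unitSq unitSq := by
  induction l with
  | nil => exact mapsTo_id _
  | cons i l ih =>
    intro a ha
    exact ⟨h.maps_f i (ih ha).1, h.maps_g i (ih ha)⟩

lemma exists_norm_fderiv_le (h : IFSHyp f g α d) :
    ∃ M : ℝ, 0 ≤ M ∧ ∀ i, ∀ a ∈ unitSq, ‖fderiv ℝ (g i) a‖ ≤ M := by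
  choose H hH using h.holder_g
  obtain ⟨M, hM⟩ := Finite.exists_le (fun i => ‖fderiv ℝ (g i) 0‖ + |H i|)
  have h0 : (0 : ℝ × ℝ) ∈ unitSq := ⟨by simp, by simp⟩
  refine ⟨max M 0, le_max_right _ _, fun i a ha => le_max_of_le_left ((hM i).trans' ?_)⟩
  have ha1 : ‖a - 0‖ ≤ 1 := by
    rw [sub_zero, Prod.norm_def, Real.norm_eq_abs, Real.norm_eq_abs,
      abs_of_nonneg ha.1.1, abs_of_nonneg ha.2.1]
    exact max_le ha.1.2 ha.2.2
  have hpow : ‖a - 0‖ ^ α ≤ 1 := Real.rpow_le_one (norm_nonneg _) ha1 h.alpha_pos.le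
  have hpow0 : 0 ≤ ‖a - 0‖ ^ α := Real.rpow_nonneg (norm_nonneg _) _
  have h1 := hH i a ha 0 h0
  have h2 := norm_le_norm_add_norm_sub' (fderiv ℝ (g i) a) (fderiv ℝ (g i) 0)
  have h3 : H i * ‖a - 0‖ ^ α ≤ |H i| :=
    (mul_le_mul_of_nonneg_right (le_abs_self _) hpow0).trans
      (mul_le_of_le_one_right (abs_nonneg _) hpow)
  linarith

lemma bddBelow_fxw_image (h : IFSHyp f g α d) (i : ι) :
    BddBelow (fxw f g [i] '' unitSq) := by
  obtain ⟨H, hH⟩ := h.holder_f i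
  refine ⟨deriv (f i) 0 - |H|, ?_⟩
  rintro _ ⟨a, ha, rfl⟩
  rw [fxw_singleton]
  have hpow : |a.1 - 0| ^ α ≤ 1 := by
    apply Real.rpow_le_one (abs_nonneg _) _ h.alpha_pos.le
    rw [sub_zero, abs_of_nonneg ha.1.1]
    exact ha.1.2
  have hpow0 : 0 ≤ |a.1 - 0| ^ α := Real.rpow_nonneg (abs_nonneg _) _
  have h1 := hH a.1 ha.1 0 (by simp)
  have h3 : H * |a.1 - 0| ^ α ≤ |H| :=
    (mul_le_mul_of_nonneg_right (le_abs_self _) hpow0).trans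
      (mul_le_of_le_one_right (abs_nonneg _) hpow)
  linarith [(abs_le.1 (h1.trans h3)).1]

lemma norm_zero_one_le : ‖((0 : ℝ), (1 : ℝ))‖ ≤ 1 := by simp [Prod.norm_def]

lemma norm_one_zero_le : ‖((1 : ℝ), (0 : ℝ))‖ ≤ 1 := by simp [Prod.norm_def]

lemma gyw_le_sSup (h : IFSHyp f g α d) (i : ι) {a : ℝ × ℝ} (ha : a ∈ unitSq) :
    gyw f g [i] a ≤ sSup (gyw f g [i] '' unitSq) := by
  obtain ⟨M, hM0, hM⟩ := h.exists_norm_fderiv_le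
  refine le_csSup ⟨M, ?_⟩ (mem_image_of_mem _ ha)
  rintro _ ⟨b, hb, rfl⟩
  rw [gyw_singleton h.diff_g]
  exact (le_abs_self _).trans
    (((fderiv ℝ (g i) b).unit_le_opNorm _ norm_zero_one_le).trans (hM i b hb))

lemma sInf_le_fxw (h : IFSHyp f g α d) (i : ι) {a : ℝ × ℝ} (ha : a ∈ unitSq) :
    sInf (fxw f g [i] '' unitSq) ≤ fxw f g [i] a :=
  csInf_le (h.bddBelow_fxw_image i) (mem_image_of_mem _ ha)

lemma gyw_pos (h : IFSHyp f g α d) (l : List ι) {a : ℝ × ℝ} (ha : a ∈ unitSq) :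
    0 < gyw f g l a := by
  induction l with
  | nil => simp [gyw, Sword]
  | cons i l ih =>
    rw [gyw_cons h.diff_f h.diff_g]
    exact mul_pos (h.d_pos.trans_le (h.dom_d i _ (h.mapsTo_Sword l ha))) ih

lemma gyw_singleton_lt_fxw (h : IFSHyp f g α d) (i : ι) {a : ℝ × ℝ} (ha : a ∈ unitSq) :
    gyw f g [i] a < fxw f g [i] a :=
  (h.gyw_le_sSup i ha).trans_lt ((h.dom i).trans_le (h.sInf_le_fxw i ha))

lemma gyw_le_fxw (h : IFSHyp f g α d) (l : List ι) {a : ℝ × ℝ} (ha : a ∈ unitSq) :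
    gyw f g l a ≤ fxw f g l a := by
  induction l with
  | nil => simp [gyw, fxw, Sword]
  | cons i l ih =>
    rw [gyw_cons h.diff_f h.diff_g, fxw_cons h.diff_f]
    have hS := h.mapsTo_Sword l ha
    have h1 := h.gyw_singleton_lt_fxw i hS
    exact mul_le_mul h1.le ih (h.gyw_pos l ha).le ((h.gyw_pos [i] hS).trans h1).le

lemma fxw_pos (h : IFSHyp f g α d) (l : List ι) {a : ℝ × ℝ} (ha : a ∈ unitSq) :
    0 < fxw f g l a :=
  (h.gyw_pos l ha).trans_le (h.gyw_le_fxw l ha)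

lemma exists_abs_gxw_le (h : IFSHyp f g α d) :
    ∃ C : ℝ, 0 ≤ C ∧ ∀ l, ∀ a ∈ unitSq, |gxw f g l a| ≤ C * fxw f g l a := by
  obtain ⟨M, hM0, hM⟩ := h.exists_norm_fderiv_le
  obtain ⟨C, hC⟩ := Finite.exists_le
    (fun i => M / (sInf (fxw f g [i] '' unitSq) - sSup (gyw f g [i] '' unitSq)))
  refine ⟨max C 0, le_max_right _ _, fun l a ha => ?_⟩
  generalize hC' : max C 0 = C'
  have hC0 : 0 ≤ C' := hC' ▸ le_max_right _ _
  induction l with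
  | nil => simpa [gxw, fxw, Sword] using hC0
  | cons i l ih =>
    have hS := h.mapsTo_Sword l ha
    have hgap : M ≤ C' * (sInf (fxw f g [i] '' unitSq) - sSup (gyw f g [i] '' unitSq)) := by
      rw [← div_le_iff₀ (sub_pos.2 (h.dom i))]
      exact (hC i).trans (hC' ▸ le_max_left _ _)
    have hx : |gxw f g [i] (Sword f g l a)| ≤ M := by
      rw [gxw_singleton h.diff_g]
      exact ((fderiv ℝ (g i) _).unit_le_opNorm _ norm_one_zero_le).trans (hM i _ hS)
    have hy := h.gyw_le_sSup i hS
    have hf := h.sInf_le_fxw i hS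
    have hy0 := h.gyw_pos [i] hS
    have hfl := h.fxw_pos l ha
    have key : M + gyw f g [i] (Sword f g l a) * C' ≤ C' * fxw f g [i] (Sword f g l a) := by
      nlinarith
    rw [gxw_cons h.diff_f h.diff_g, fxw_cons h.diff_f]
    calc _ ≤ |gxw f g [i] (Sword f g l a)| * fxw f g l a +
          gyw f g [i] (Sword f g l a) * |gxw f g l a| := by
            refine (abs_add_le _ _).trans (le_of_eq ?_)
            rw [abs_mul, abs_mul, abs_of_pos hfl, abs_of_pos hy0]
      _ ≤ M * fxw f g l a + gyw f g [i] (Sword f g l a) * (C' * fxw f g l a) := by gcongr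
      _ = (M + gyw f g [i] (Sword f g l a) * C') * fxw f g l a := by ring
      _ ≤ (C' * fxw f g [i] (Sword f g l a)) * fxw f g l a := by gcongr
      _ = _ := by ring

lemma exists_contraction (h : IFSHyp f g α d) :
    ∃ c : ℝ, 0 ≤ c ∧ c < 1 ∧ ∀ l, ∀ a ∈ unitSq, ∀ b ∈ unitSq,
      ‖Sword f g l a - Sword f g l b‖ ≤ c ^ l.length := by
  choose cf hcf0 hcf1 hcf using h.contr_f
  choose cg hcg0 hcg1 hcg using h.contr_g
  have : Nonempty ι := Fintype.card_pos_iff.1 (two_pos.trans_le h.card2)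
  obtain ⟨j, hj⟩ := Finite.exists_max (fun i => max (cf i) (cg i))
  set c := max (cf j) (cg j) with hc
  have hc0 : 0 ≤ c := le_max_of_le_left (hcf0 j)
  refine ⟨c, hc0, max_lt (hcf1 j) (hcg1 j), fun l a ha b hb => ?_⟩
  induction l with
  | nil =>
    have h1 := abs_sub_le_of_nonneg_of_le ha.1.1 ha.1.2 hb.1.1 hb.1.2
    have h2 := abs_sub_le_of_nonneg_of_le ha.2.1 ha.2.2 hb.2.1 hb.2.2
    simpa [Sword, Prod.norm_def] using And.intro h1 h2
  | cons i l ih =>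
    have hSa := h.mapsTo_Sword l ha
    have hSb := h.mapsTo_Sword l hb
    have h1 := hcf i _ hSa.1 _ hSb.1
    have h2 := hcg i _ hSa _ hSb
    have h3 : |(Sword f g l a).1 - (Sword f g l b).1| ≤ ‖Sword f g l a - Sword f g l b‖ :=
      norm_fst_le (Sword f g l a - Sword f g l b)
    rw [List.length_cons, pow_succ']
    refine max_le ?_ ?_
    · exact h1.trans (mul_le_mul ((le_max_left _ _).trans (hj i)) (h3.trans ih)
        (abs_nonneg _) hc0)
    · exact h2.trans (mul_le_mul ((le_max_right _ _).trans (hj i)) ih (norm_nonneg _) hc0)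

lemma exists_gyw_distortion (h : IFSHyp f g α d) :
    ∃ B : ℝ, 0 < B ∧ ∀ l, ∀ a ∈ unitSq, ∀ b ∈ unitSq, gyw f g l a ≤ B * gyw f g l b := by
  choose H hH using h.holder_g
  obtain ⟨A, hA⟩ := Finite.exists_le (fun i => |H i| / d)
  have : Nonempty ι := Fintype.card_pos_iff.1 (two_pos.trans_le h.card2)
  have hA0 : 0 ≤ A := (div_nonneg (abs_nonneg _) h.d_pos.le).trans (hA (Classical.arbitrary ι))
  obtain ⟨c, hc0, hc1, hc⟩ := h.exists_contraction
  have hr0 : 0 ≤ c ^ α := Real.rpow_nonneg hc0 _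
  have hr1 : c ^ α < 1 := Real.rpow_lt_one hc0 hc1 h.alpha_pos
  have hsum : ∀ l, ∀ a ∈ unitSq, ∀ b ∈ unitSq, gyw f g l a ≤
      Real.exp (A * ∑ k ∈ Finset.range l.length, (c ^ α) ^ k) * gyw f g l b := by
    intro l a ha b hb
    induction l with
    | nil => simp [gyw, Sword]
    | cons i l ih =>
      have hSa := h.mapsTo_Sword l ha
      have hSb := h.mapsTo_Sword l hb
      have hpow : ‖Sword f g l a - Sword f g l b‖ ^ α ≤ (c ^ α) ^ l.length := by
        rw [← Real.rpow_natCast, ← Real.rpow_mul hc0, mul_comm, Real.rpow_mul hc0,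
          Real.rpow_natCast]
        exact Real.rpow_le_rpow (norm_nonneg _) (hc l a ha b hb) h.alpha_pos.le
      have hdiff : gyw f g [i] (Sword f g l a) - gyw f g [i] (Sword f g l b) ≤
          A * d * (c ^ α) ^ l.length := by
        rw [gyw_singleton h.diff_g, gyw_singleton h.diff_g, ← sub_apply]
        calc _ ≤ ‖fderiv ℝ (g i) (Sword f g l a) - fderiv ℝ (g i) (Sword f g l b)‖ :=
              (le_abs_self _).trans
                ((fderiv ℝ (g i) (Sword f g l a) - fderiv ℝ (g i) (Sword f g l b)).unit_le_opNorm _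
                  norm_zero_one_le)
          _ ≤ H i * ‖Sword f g l a - Sword f g l b‖ ^ α := hH i _ hSa _ hSb
          _ ≤ |H i| * (c ^ α) ^ l.length := by
              refine mul_le_mul (le_abs_self _) hpow ?_ (abs_nonneg _)
              exact Real.rpow_nonneg (norm_nonneg _) _
          _ ≤ A * d * (c ^ α) ^ l.length := by
              gcongr
              exact (div_le_iff₀ h.d_pos).1 (hA i)
      have hstep : gyw f g [i] (Sword f g l a) ≤
          Real.exp (A * (c ^ α) ^ l.length) * gyw f g [i] (Sword f g l b) := by
        have h1 := Real.add_one_le_exp (A * (c ^ α) ^ l.length)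
        have h2 := h.dom_d i _ hSb
        have h3 : 0 ≤ A * (c ^ α) ^ l.length := by positivity
        have h4 := h.gyw_pos [i] hSb
        nlinarith [mul_le_mul_of_nonneg_right h1 h4.le, mul_le_mul_of_nonneg_left h2 h3]
      rw [gyw_cons h.diff_f h.diff_g i l a, gyw_cons h.diff_f h.diff_g i l b, List.length_cons,
        Finset.sum_range_succ, mul_add, Real.exp_add]
      calc _ ≤ _ := mul_le_mul hstep ih (h.gyw_pos l ha).le
            (mul_nonneg (Real.exp_pos _).le (h.gyw_pos [i] hSb).le)
        _ = _ := by ring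
  refine ⟨Real.exp (A * (1 - c ^ α)⁻¹), Real.exp_pos _, fun l a ha b hb => ?_⟩
  refine (hsum l a ha b hb).trans (mul_le_mul_of_nonneg_right ?_ (h.gyw_pos l hb).le)
  gcongr
  rw [← tsum_geometric_of_lt_one hr0 hr1]
  exact (summable_geometric_of_lt_one hr0 hr1).sum_le_tsum _ fun k _ => pow_nonneg hr0 k

lemma monotoneOn_fword (h : IFSHyp f g α d) (l : List ι) :
    MonotoneOn (fword f l) (Icc 0 1) := by
  have hd := differentiable_fword h.diff_f l
  refine monotoneOn_of_deriv_nonneg (convex_Icc 0 1) hd.continuous.continuousOn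
    hd.differentiableOn fun x hx => ?_
  rw [← fxw_eq_deriv_fword (g := g) l (x, 0)]
  exact (h.fxw_pos l ⟨interior_subset hx, by simp⟩).le

lemma abs_snd_Sword_sub_le_fword (h : IFSHyp f g α d) {C : ℝ} {l : List ι}
    (hC : ∀ a ∈ unitSq, |gxw f g l a| ≤ C * fxw f g l a) {y x x' : ℝ} (hy : y ∈ Icc (0 : ℝ) 1)
    (hx : x ∈ Icc (0 : ℝ) 1) (hx' : x' ∈ Icc (0 : ℝ) 1) (hxx' : x ≤ x') :
    |(Sword f g l (x', y)).2 - (Sword f g l (x, y)).2| ≤ C * (fword f l x' - fword f l x) := by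
  have hF : ∀ t, HasDerivAt (fword f l) (fxw f g l (t, y)) t :=
    fun t => hasDerivAt_fword h.diff_f l (t, y)
  have hG : ∀ t, HasDerivAt (fun t => (Sword f g l (t, y)).2) (gxw f g l (t, y)) t :=
    fun t => hasDerivAt_gxw h.diff_f h.diff_g l (t, y)
  have mono : ∀ {u u' : ℝ → ℝ}, (∀ t, HasDerivAt u (u' t) t) →
      (∀ t ∈ Icc (0 : ℝ) 1, 0 ≤ u' t) → u x ≤ u x' := by
    intro u u' hu hu'
    refine monotoneOn_of_deriv_nonneg (convex_Icc 0 1)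
      (fun t _ => (hu t).continuousAt.continuousWithinAt)
      (fun t _ => (hu t).differentiableAt.differentiableWithinAt) (fun t ht => ?_) hx hx' hxx'
    rw [(hu t).deriv]
    exact hu' t (interior_subset ht)
  have h1 := mono (fun t => ((hF t).const_mul C).sub (hG t)) fun t ht => by
    linarith [(abs_le.1 (hC (t, y) ⟨ht, hy⟩)).2]
  have h2 := mono (fun t => ((hF t).const_mul C).add (hG t)) fun t ht => by
    linarith [(abs_le.1 (hC (t, y) ⟨ht, hy⟩)).1]
  simp only [Pi.sub_apply, Pi.add_apply] at h1 h2
  rw [abs_le]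
  constructor <;> linarith

lemma exists_snd_Sword_vertical_eq (h : IFSHyp f g α d) (l : List ι) (x : ℝ) :
    ∃ t ∈ Icc (0 : ℝ) 1,
      (Sword f g l (x, 1)).2 - (Sword f g l (x, 0)).2 = gyw f g l (x, t) := by
  have hG : ∀ t, HasDerivAt (fun t => (Sword f g l (x, t)).2) (gyw f g l (x, t)) t :=
    fun t => hasDerivAt_gyw h.diff_f h.diff_g l (x, t)
  obtain ⟨t, ht, hteq⟩ := exists_hasDerivAt_eq_slope (fun t => (Sword f g l (x, t)).2)
    (fun t => gyw f g l (x, t)) zero_lt_one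
    (fun t _ => (hG t).continuousAt.continuousWithinAt) (fun t _ => hG t)
  exact ⟨t, Ioo_subset_Icc_self ht, by simpa using hteq.symm⟩

end IFSHyp

theorem stopping_strip_height {ι : Type*} [Fintype ι]
    (f : ι → ℝ → ℝ) (g : ι → ℝ × ℝ → ℝ) (α d : ℝ) (h : IFSHyp f g α d) :
    ∃ K : ℝ, 0 < K ∧ ∀ a ∈ unitSq, ∀ δ : ℝ, 0 < δ → δ ≤ 1 → ∀ l ∈ stopping f g a δ,
      ∀ a₀ b₀ : ℝ, 0 ≤ a₀ → a₀ ≤ b₀ → b₀ ≤ 1 → |fword f l b₀ - fword f l a₀| ≤ δ →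
        ∀ a' ∈ Set.Icc a₀ b₀, ∀ b' ∈ Set.Icc a₀ b₀,
          |(Sword f g l (b', 1)).2 - (Sword f g l (a', 0)).2| ≤ K * δ := by
  obtain ⟨C, hC0, hC⟩ := h.exists_abs_gxw_le
  obtain ⟨B, hB0, hB⟩ := h.exists_gyw_distortion
  refine ⟨B * Real.sqrt (2 + C ^ 2) + C, by positivity, ?_⟩
  intro a ha δ hδ _ l hl a₀ b₀ ha₀ hab hb₀ hfδ a' ha' b' hb'
  have ha'1 : a' ∈ Icc (0 : ℝ) 1 := ⟨ha₀.trans ha'.1, ha'.2.trans hb₀⟩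
  have hb'1 : b' ∈ Icc (0 : ℝ) 1 := ⟨ha₀.trans hb'.1, hb'.2.trans hb₀⟩
  have ha₀1 : a₀ ∈ Icc (0 : ℝ) 1 := ⟨ha₀, hab.trans hb₀⟩
  have hb₀1 : b₀ ∈ Icc (0 : ℝ) 1 := ⟨ha₀.trans hab, hb₀⟩
  have hmono := h.monotoneOn_fword l
  have hvert : |(Sword f g l (b', 1)).2 - (Sword f g l (b', 0)).2| ≤
      B * Real.sqrt (2 + C ^ 2) * δ := by
    obtain ⟨t, ht, hteq⟩ := h.exists_snd_Sword_vertical_eq l b'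
    have hmem : (b', t) ∈ unitSq := ⟨hb'1, ht⟩
    rw [hteq, abs_of_pos (h.gyw_pos l hmem), mul_assoc]
    refine (hB l _ hmem a ha).trans (mul_le_mul_of_nonneg_left ?_ hB0.le)
    exact (sv2_lower_bound (h.gyw_pos l ha) (h.gyw_le_fxw l ha) (hC l a ha)).trans
      (mul_le_mul_of_nonneg_left hl.2.1.le (Real.sqrt_nonneg _))
  have hstrip : ∀ x ∈ Icc a₀ b₀, ∀ x' ∈ Icc a₀ b₀, x ≤ x' →
      |(Sword f g l (x', 0)).2 - (Sword f g l (x, 0)).2| ≤ C * δ := by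
    intro x hx x' hx' hxx'
    have hx1 : x ∈ Icc (0 : ℝ) 1 := ⟨ha₀.trans hx.1, hx.2.trans hb₀⟩
    have hx'1 : x' ∈ Icc (0 : ℝ) 1 := ⟨ha₀.trans hx'.1, hx'.2.trans hb₀⟩
    refine (h.abs_snd_Sword_sub_le_fword (hC l) (by simp) hx1 hx'1 hxx').trans ?_
    refine mul_le_mul_of_nonneg_left ?_ hC0
    linarith [hmono ha₀1 hx1 hx.1, hmono hx'1 hb₀1 hx'.2, le_abs_self (fword f l b₀ - fword f l a₀)]
  have hhor : |(Sword f g l (b', 0)).2 - (Sword f g l (a', 0)).2| ≤ C * δ := by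
    rcases le_total a' b' with hle | hle
    · exact hstrip a' ha' b' hb' hle
    · rw [abs_sub_comm]
      exact hstrip b' hb' a' ha' hle
  have htri := abs_sub_le (Sword f g l (b', 1)).2 (Sword f g l (b', 0)).2 (Sword f g l (a', 0)).2
  linarith

end
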